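/- (Correctness of the Set Cover reduction, unrestricted coalition size.) Let U = {u_1,…,u_N} be a finite universe, F = {S_1,…,S_M} a family of subsets of U, and k an integer with 3 ≤ k ≤ M. Assume that every element of U occurs in at most three sets of F and that no union of fewer than three sets of F equals U. Construct a team power game exactly as follows. Time slots: one element slot e_j for each u_j ∈ U, plus two slots α and β. Teams: one set team t_i for each S_i ∈ F with true availability 1 at α, 1 at β, and 1 at e_j for each u_j ∈ S_i (and 0 elsewhere); for each element slot e_j, exactly 2M − 1 − #(u_j) dummy teams (where #(u_j) is the number of sets of F containing u_j), each with true availability 1 at e_j and 0 elsewhere; M dummy teams with true availability 1 at α and 0 elsewhere; and 2M − 1 − k dummy teams with true availability 1 at β and 0 elsewhere. Let the strategy profile B agree with the true availabilities everywhere except that every set team declares 0 at β. Then some nonempty coalition of teams (of arbitrary size) has an improvement step with respect to B if and only if there exists a subfamily F' ⊆ F with |F'| ≤ k and ∪_{S ∈ F'} S = U. -/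

import Mathlib

open Finset

section TPG

variable {T C : Type*} [Fintype T] [Fintype C] [DecidableEq T] [DecidableEq C]

/-- Sum of declared availabilities at a time slot. -/
def colSum (B : T → C → ℕ) (j : C) : ℕ := ∑ i, B i j

/-- Winning time slots: those maximizing the column sum. -/
def winners (B : T → C → ℕ) : Finset C :=
  Finset.univ.filter fun j => ∀ j', colSum B j' ≤ colSum B j

/-- Relative power of team `i` at slot `j` (0 when the denominator is 0). -/
def power (B : T → C → ℕ) (i : T) (j : C) : ℚ :=
  (B i j : ℚ) / (colSum B j : ℚ)

/-- Pay-off of team `i`: minimum relative power over all winning slots. -/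
def payoff (B : T → C → ℕ) (i : T) : ℚ :=
  if h : (winners B).Nonempty then (winners B).inf' h (power B i) else 0

/-- `B` is a strategy profile for input `A`. -/
def IsProfile (A B : T → C → ℕ) : Prop := ∀ i j, B i j ≤ A i j

/-- `D` is an improvement step for coalition `S` with respect to `B` (for input `A`). -/
def IsImprovement (A B : T → C → ℕ) (S : Finset T) (D : T → C → ℕ) : Prop :=
  IsProfile A D ∧ (∀ i ∉ S, ∀ j, D i j = B i j) ∧ ∀ i ∈ S, payoff B i < payoff D i

/-- `B` is a `t`-strong Nash equilibrium for `A`. -/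
def IsStrongNash (t : ℕ) (A B : T → C → ℕ) : Prop :=
  IsProfile A B ∧
    ∀ S : Finset T, S.Nonempty → S.card ≤ t → ∀ D, ¬ IsImprovement A B S D

end TPG

section SetCoverReduction

/-- Number of sets of the family `F` containing element `j`. -/
def occCount (N M : ℕ) (F : Fin M → Finset (Fin N)) (j : Fin N) : ℕ :=
  (Finset.univ.filter fun i : Fin M => j ∈ F i).card

/-- Teams of the reduced game: set teams, element-slot dummies, α-dummies, β-dummies. -/
abbrev SCTeam (N M k : ℕ) (F : Fin M → Finset (Fin N)) : Type :=
  (Fin M) ⊕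
    ((Σ j : Fin N, Fin (2 * M - 1 - occCount N M F j)) ⊕
      (Fin M ⊕ Fin (2 * M - 1 - k)))

/-- Time slots of the reduced game: element slots plus `α = Sum.inr false` and
`β = Sum.inr true`. -/
abbrev SCSlot (N : ℕ) : Type := (Fin N) ⊕ Bool

/-- True availabilities of the reduced game. -/
def scA (N M k : ℕ) (F : Fin M → Finset (Fin N)) :
    SCTeam N M k F → SCSlot N → ℕ := fun t s =>
  match t, s with
  | Sum.inl i, Sum.inl j => if j ∈ F i then 1 else 0
  | Sum.inl _, Sum.inr _ => 1
  | Sum.inr (Sum.inl ⟨j, _⟩), Sum.inl j' => if j' = j then 1 else 0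
  | Sum.inr (Sum.inl _), Sum.inr _ => 0
  | Sum.inr (Sum.inr (Sum.inl _)), Sum.inr false => 1
  | Sum.inr (Sum.inr (Sum.inl _)), _ => 0
  | Sum.inr (Sum.inr (Sum.inr _)), Sum.inr true => 1
  | Sum.inr (Sum.inr (Sum.inr _)), _ => 0

/-- Declared availabilities: truthful, except that set teams declare `0` at `β`. -/
def scB (N M k : ℕ) (F : Fin M → Finset (Fin N)) :
    SCTeam N M k F → SCSlot N → ℕ := fun t s =>
  match t, s with
  | Sum.inl _, Sum.inr true => 0
  | t, s => scA N M k F t s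

lemma winners_nonempty {T C : Type*} [Fintype T] [Fintype C] [Nonempty C]
    (B : T → C → ℕ) : (winners B).Nonempty := by
  obtain ⟨j, hj⟩ := Finite.exists_max (colSum B)
  exact ⟨j, by simpa [winners] using hj⟩

lemma payoff_le_power {T C : Type*} [Fintype T] [Fintype C] (B : T → C → ℕ) (i : T)
    {w : C} (hw : w ∈ winners B) : payoff B i ≤ power B i w := by
  have h : (winners B).Nonempty := ⟨w, hw⟩
  simpa only [payoff, dif_pos h] using Finset.inf'_le _ hw

lemma payoff_nonneg {T C : Type*} [Fintype T] [Fintype C] (B : T → C → ℕ) (i : T) :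
    0 ≤ payoff B i := by
  unfold payoff
  split_ifs with h
  · exact Finset.le_inf' _ _ fun j _ => by unfold power; positivity
  · rfl

lemma payoff_eq_power_of_colSum_lt {T C : Type*} [Fintype T] [Fintype C]
    (B : T → C → ℕ) (i : T) {w : C} (hw : ∀ j, j ≠ w → colSum B j < colSum B w) :
    payoff B i = power B i w := by
  have h : winners B = {w} := by
    ext j
    simp only [winners, mem_filter, mem_univ, true_and, mem_singleton]
    constructor
    · intro hj
      by_contra hne
      exact absurd (hj w) (not_le.mpr (hw j hne))
    · rintro rfl j'
      by_cases hj : j' = j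
      · rw [hj]
      · exact (hw j' hj).le
  simp [payoff, h]

section Reduction

variable {N M k : ℕ} {F : Fin M → Finset (Fin N)}

lemma scA_le_one (t : SCTeam N M k F) (s : SCSlot N) : scA N M k F t s ≤ 1 := by
  rcases t with i | ⟨j, d⟩ | d | d <;> rcases s with j' | _ | _ <;> simp only [scA] <;>
    first | omega | (split_ifs <;> omega)

lemma scB_le_scA (t : SCTeam N M k F) (s : SCSlot N) : scB N M k F t s ≤ scA N M k F t s := by
  rcases t with i | ⟨j, d⟩ | d | d <;> rcases s with j' | _ | _ <;> simp [scB, scA]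

lemma scB_dummy (d) (s : SCSlot N) :
    scB N M k F (Sum.inr d) s = scA N M k F (Sum.inr d) s := by
  rcases d with ⟨j, d⟩ | d | d <;> rcases s with j' | _ | _ <;> rfl

lemma scB_of_ne_beta (t : SCTeam N M k F) {s : SCSlot N} (hs : s ≠ Sum.inr true) :
    scB N M k F t s = scA N M k F t s := by
  rcases t with i | ⟨j, d⟩ | d | d <;> rcases s with j' | _ | _ <;> first | rfl | simp at hs

lemma colSum_element (D : SCTeam N M k F → SCSlot N → ℕ)
    (hD : ∀ d s, D (Sum.inr d) s = scA N M k F (Sum.inr d) s) (j : Fin N) :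
    colSum D (Sum.inl j) =
      ∑ i, D (Sum.inl i) (Sum.inl j) + (2 * M - 1 - occCount N M F j) := by
  have hdummies : ∑ d, scA N M k F (Sum.inr (Sum.inl d)) (Sum.inl j) =
      2 * M - 1 - occCount N M F j := by
    rw [Fintype.sum_sigma]
    simp [scA]
  simp only [colSum, Fintype.sum_sum_type, hD, hdummies]
  simp [scA]

lemma colSum_alpha (D : SCTeam N M k F → SCSlot N → ℕ)
    (hD : ∀ d s, D (Sum.inr d) s = scA N M k F (Sum.inr d) s) :
    colSum D (Sum.inr false) = ∑ i, D (Sum.inl i) (Sum.inr false) + M := by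
  simp [colSum, Fintype.sum_sum_type, hD, scA]

lemma colSum_beta (D : SCTeam N M k F → SCSlot N → ℕ)
    (hD : ∀ d s, D (Sum.inr d) s = scA N M k F (Sum.inr d) s) :
    colSum D (Sum.inr true) = ∑ i, D (Sum.inl i) (Sum.inr true) + (2 * M - 1 - k) := by
  simp [colSum, Fintype.sum_sum_type, hD, scA]

lemma colSum_scB_element (hM : 3 ≤ M) {j : Fin N} (hocc : occCount N M F j ≤ 3) :
    colSum (scB N M k F) (Sum.inl j) = 2 * M - 1 := by
  have h : ∑ i, scB N M k F (Sum.inl i) (Sum.inl j) = occCount N M F j := by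
    simp [scB, scA, occCount]
  rw [colSum_element _ scB_dummy, h]
  omega

lemma colSum_scB_alpha : colSum (scB N M k F) (Sum.inr false) = 2 * M := by
  rw [colSum_alpha _ scB_dummy]
  simp [scB, scA, two_mul]

lemma colSum_scB_beta : colSum (scB N M k F) (Sum.inr true) = 2 * M - 1 - k := by
  rw [colSum_beta _ scB_dummy]
  simp [scB]

lemma colSum_scB_lt_alpha (hM : 3 ≤ M) (hocc : ∀ j, occCount N M F j ≤ 3)
    (s : SCSlot N) (hs : s ≠ Sum.inr false) :
    colSum (scB N M k F) s < colSum (scB N M k F) (Sum.inr false) := by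
  rw [colSum_scB_alpha]
  rcases s with j | _ | _
  · rw [colSum_scB_element hM (hocc j)]; omega
  · exact absurd rfl hs
  · rw [colSum_scB_beta]; omega

lemma payoff_scB (hM : 3 ≤ M) (hocc : ∀ j, occCount N M F j ≤ 3) (t : SCTeam N M k F) :
    payoff (scB N M k F) t = (scA N M k F t (Sum.inr false) : ℚ) / (2 * M : ℕ) := by
  rw [payoff_eq_power_of_colSum_lt _ t (colSum_scB_lt_alpha hM hocc), power, colSum_scB_alpha,
    scB_of_ne_beta t (by simp)]

/-- The set teams in `G` move their declarations to `β` and withdraw from all other slots. -/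
def scMoveToBeta (N M k : ℕ) (F : Fin M → Finset (Fin N)) (G : Finset (Fin M)) :
    SCTeam N M k F → SCSlot N → ℕ
  | Sum.inl i, Sum.inl j => if i ∈ G then 0 else if j ∈ F i then 1 else 0
  | Sum.inl i, Sum.inr false => if i ∈ G then 0 else 1
  | Sum.inl i, Sum.inr true => if i ∈ G then 1 else 0
  | Sum.inr d, s => scA N M k F (Sum.inr d) s

lemma isImprovement_scMoveToBeta (hk3 : 3 ≤ k) (hkM : k ≤ M)
    (hocc : ∀ j, occCount N M F j ≤ 3) {G : Finset (Fin M)} (hG : G.card = k)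
    (hcover : G.biUnion F = Finset.univ) :
    IsImprovement (scA N M k F) (scB N M k F) (G.map Function.Embedding.inl)
      (scMoveToBeta N M k F G) := by
  have hdummy : ∀ d s, scMoveToBeta N M k F G (Sum.inr d) s = scA N M k F (Sum.inr d) s :=
    fun _ _ => rfl
  have hbeta : colSum (scMoveToBeta N M k F G) (Sum.inr true) = 2 * M - 1 := by
    rw [colSum_beta _ hdummy]
    simp only [scMoveToBeta, sum_boole, filter_univ_mem, hG, Nat.cast_id]
    omega
  have hwin : ∀ s, s ≠ Sum.inr true → colSum (scMoveToBeta N M k F G) s <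
      colSum (scMoveToBeta N M k F G) (Sum.inr true) := by
    intro s hs
    rw [hbeta]
    rcases s with j | _ | _
    · obtain ⟨i, hiG, hij⟩ : ∃ i ∈ G, j ∈ F i := by
        simpa using hcover.ge (Finset.mem_univ j)
      have hlt : ∑ i, scMoveToBeta N M k F G (Sum.inl i) (Sum.inl j) < occCount N M F j := by
        rw [occCount, Finset.card_filter]
        refine Finset.sum_lt_sum (fun i _ => ?_) ⟨i, Finset.mem_univ i, ?_⟩
        · simp only [scMoveToBeta]
          split_ifs <;> simp
        · simp [scMoveToBeta, hiG, hij]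
      rw [colSum_element _ hdummy]
      have := hocc j
      omega
    · have hsum : ∑ i, scMoveToBeta N M k F G (Sum.inl i) (Sum.inr false) = M - k := by
        have : ∀ i, scMoveToBeta N M k F G (Sum.inl i) (Sum.inr false) =
            if i ∈ Gᶜ then 1 else 0 := fun i => by
          simp only [scMoveToBeta, mem_compl]
          split_ifs <;> simp_all
        simp only [this, sum_boole, filter_univ_mem, Nat.cast_id, card_compl, hG, Fintype.card_fin]
      rw [colSum_alpha _ hdummy, hsum]
      omega
    · exact absurd rfl hs
  refine ⟨?_, ?_, ?_⟩
  · rintro (i | d) s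
    · rcases s with j | _ | _ <;> simp only [scMoveToBeta, scA] <;> split_ifs <;> simp
    · exact le_rfl
  · rintro (i | d) hi s
    · have hiG : i ∉ G := by simpa using hi
      rcases s with j | _ | _ <;> simp [scMoveToBeta, scB, scA, hiG]
    · exact (scB_dummy d s).symm
  · intro t ht
    obtain ⟨i, hi, rfl⟩ := Finset.mem_map.mp ht
    rw [payoff_scB (hk3.trans hkM) hocc, payoff_eq_power_of_colSum_lt _ _ hwin, power, hbeta]
    simp only [Function.Embedding.inl_apply, scA, scMoveToBeta, hi, if_true, Nat.cast_one]
    apply one_div_lt_one_div_of_lt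
    · exact_mod_cast (by omega : 0 < 2 * M - 1)
    · exact_mod_cast (by omega : 2 * M - 1 < 2 * M)

lemma apply_winner_of_isImprovement {S : Finset (SCTeam N M k F)}
    {D : SCTeam N M k F → SCSlot N → ℕ}
    (hD : IsImprovement (scA N M k F) (scB N M k F) S D) {t : SCTeam N M k F} (ht : t ∈ S)
    {w : SCSlot N} (hw : w ∈ winners D) : D t w = 1 ∧ scA N M k F t w = 1 := by
  have hpos : 0 < power D t w :=
    ((payoff_nonneg _ t).trans_lt (hD.2.2 t ht)).trans_le (payoff_le_power D t hw)
  have hne : D t w ≠ 0 := by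
    intro h
    simp [power, h] at hpos
  have := hD.1 t w
  have := scA_le_one t w
  omega

lemma colSum_winner_lt_of_isImprovement (hM : 3 ≤ M) (hocc : ∀ j, occCount N M F j ≤ 3)
    {S : Finset (SCTeam N M k F)} {D : SCTeam N M k F → SCSlot N → ℕ}
    (hD : IsImprovement (scA N M k F) (scB N M k F) S D) {t : SCTeam N M k F} (ht : t ∈ S)
    (hα : scA N M k F t (Sum.inr false) = 1) {w : SCSlot N} (hw : w ∈ winners D) :
    colSum D w < 2 * M := by
  have h := (hD.2.2 t ht).trans_le (payoff_le_power D t hw)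
  rw [payoff_scB hM hocc, hα, power, (apply_winner_of_isImprovement hD ht hw).1, Nat.cast_one] at h
  by_contra! hle
  refine absurd h (not_lt.mpr (one_div_le_one_div_of_le ?_ (by exact_mod_cast hle)))
  exact_mod_cast (by omega : 0 < 2 * M)

lemma alpha_notMem_winners_of_isImprovement (hM : 3 ≤ M) (hocc : ∀ j, occCount N M F j ≤ 3)
    {S : Finset (SCTeam N M k F)} {D : SCTeam N M k F → SCSlot N → ℕ} (hS : S.Nonempty)
    (hD : IsImprovement (scA N M k F) (scB N M k F) S D) : Sum.inr false ∉ winners D := by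
  intro hw
  obtain ⟨t, ht⟩ := hS
  have hlt := colSum_winner_lt_of_isImprovement hM hocc hD ht
    (apply_winner_of_isImprovement hD ht hw).2 hw
  have hlt := hlt.trans_eq (colSum_scB_alpha (k := k) (F := F)).symm
  refine absurd hlt (not_lt.mpr (Finset.sum_le_sum fun i _ => ?_))
  by_cases hi : i ∈ S
  · rw [(apply_winner_of_isImprovement hD hi hw).1]
    exact (scB_le_scA i _).trans (scA_le_one i _)
  · rw [hD.2.1 i hi]

lemma exists_set_team_of_isImprovement (hM : 3 ≤ M) (hocc : ∀ j, occCount N M F j ≤ 3)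
    {S : Finset (SCTeam N M k F)} {D : SCTeam N M k F → SCSlot N → ℕ} (hS : S.Nonempty)
    (hD : IsImprovement (scA N M k F) (scB N M k F) S D) : ∃ i, Sum.inl i ∈ S := by
  by_contra! hno
  obtain ⟨w, hw⟩ := winners_nonempty D
  have hwα : w ≠ Sum.inr false := by
    rintro rfl
    exact alpha_notMem_winners_of_isImprovement hM hocc hS hD hw
  have hle : ∀ t, D t w ≤ scB N M k F t w := by
    rintro (i | d)
    · rw [hD.2.1 _ (hno i)]
    · rw [scB_dummy]
      exact hD.1 _ _
  have hα : ∀ t, D t (Sum.inr false) = scB N M k F t (Sum.inr false) := by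
    intro t
    by_cases ht : t ∈ S
    · rcases t with i | ⟨j, d⟩ | d | d
      · exact absurd ht (hno i)
      · have := hD.1 (Sum.inr (Sum.inl ⟨j, d⟩)) (Sum.inr false)
        simp only [scA] at this
        simp only [scB, scA]
        omega
      · have := (apply_winner_of_isImprovement hD ht hw).2
        rcases w with j | _ | _ <;> simp [scA] at this hwα
      · have := hD.1 (Sum.inr (Sum.inr (Sum.inr d))) (Sum.inr false)
        simp only [scA] at this
        simp only [scB, scA]
        omega
    · exact hD.2.1 t ht _
  have h₁ : colSum D w ≤ colSum (scB N M k F) w := Finset.sum_le_sum fun t _ => hle t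
  have h₂ : colSum D (Sum.inr false) = colSum (scB N M k F) (Sum.inr false) :=
    Finset.sum_congr rfl fun t _ => hα t
  have h₃ := colSum_scB_lt_alpha (k := k) hM hocc w hwα
  have h₄ := (Finset.mem_filter.mp hw).2 (Sum.inr false)
  omega

lemma biUnion_eq_univ_of_isImprovement (hM : 3 ≤ M) (hocc : ∀ j, occCount N M F j ≤ 3)
    {S : Finset (SCTeam N M k F)} {D : SCTeam N M k F → SCSlot N → ℕ} (hS : S.Nonempty)
    (hD : IsImprovement (scA N M k F) (scB N M k F) S D) :
    (Finset.univ.filter fun i => Sum.inl i ∈ S).biUnion F = Finset.univ := by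
  obtain ⟨i₀, hi₀⟩ := exists_set_team_of_isImprovement hM hocc hS hD
  obtain ⟨w, hw⟩ := winners_nonempty D
  have hlt := colSum_winner_lt_of_isImprovement hM hocc hD hi₀ rfl hw
  rw [Finset.eq_univ_iff_forall]
  intro j
  by_contra hj
  have hj : ∀ i, Sum.inl i ∈ S → j ∉ F i := by simpa using hj
  have hjw : Sum.inl j ∉ winners D := fun h => by
    simpa [scA, hj i₀ hi₀] using (apply_winner_of_isImprovement hD hi₀ h).2
  have hge : colSum (scB N M k F) (Sum.inl j) ≤ colSum D (Sum.inl j) := by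
    refine Finset.sum_le_sum fun t _ => ?_
    by_cases ht : t ∈ S
    · rcases t with i | ⟨j', d⟩ | d | d
      · simp [scB, scA, hj i ht]
      · by_cases hjj : j = j'
        · subst hjj
          have := (apply_winner_of_isImprovement hD ht hw).2
          rcases w with j' | _ | _
          · obtain rfl : j' = j := by simpa [scA] using this
            exact absurd hw hjw
          · simp [scA] at this
          · simp [scA] at this
        · simp [scB, scA, hjj]
      · simp [scB, scA]
      · simp [scB, scA]
    · rw [hD.2.1 t ht]
  rw [colSum_scB_element hM (hocc j)] at hge
  have hmax := (Finset.mem_filter.mp hw).2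
  exact hjw (Finset.mem_filter.mpr ⟨Finset.mem_univ _, fun s => (hmax s).trans (by omega)⟩)

lemma card_le_of_isImprovement (hk3 : 3 ≤ k) (hkM : k ≤ M) (hocc : ∀ j, occCount N M F j ≤ 3)
    {S : Finset (SCTeam N M k F)} {D : SCTeam N M k F → SCSlot N → ℕ} (hS : S.Nonempty)
    (hD : IsImprovement (scA N M k F) (scB N M k F) S D) :
    (Finset.univ.filter fun i : Fin M => Sum.inl i ∈ S).card ≤ k := by
  have hM := hk3.trans hkM
  obtain ⟨w, hw⟩ := winners_nonempty D
  rcases w with j | _ | _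
  · refine le_trans (Finset.card_le_card fun i hi => ?_) ((hocc j).trans hk3)
    simpa [scA] using (apply_winner_of_isImprovement hD (Finset.mem_filter.mp hi).2 hw).2
  · exact absurd hw (alpha_notMem_winners_of_isImprovement hM hocc hS hD)
  · obtain ⟨i₀, hi₀⟩ := exists_set_team_of_isImprovement hM hocc hS hD
    have hlt := colSum_winner_lt_of_isImprovement hM hocc hD hi₀ rfl hw
    have hsets : (Finset.univ.filter fun i : Fin M => Sum.inl i ∈ S).card ≤
        ∑ i, D (Sum.inl i) (Sum.inr true) := by
      rw [Finset.card_filter]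
      refine Finset.sum_le_sum fun i _ => ?_
      split_ifs with hi
      · exact (apply_winner_of_isImprovement hD hi hw).1.ge
      · exact Nat.zero_le _
    have hdummies : ∑ d, scA N M k F (Sum.inr d) (Sum.inr true) ≤
        ∑ d, D (Sum.inr d) (Sum.inr true) := by
      refine Finset.sum_le_sum fun d _ => ?_
      by_cases hd : Sum.inr d ∈ S
      · exact (scA_le_one _ _).trans (apply_winner_of_isImprovement hD hd hw).1.ge
      · rw [hD.2.1 _ hd, scB_dummy]
    have hcount : ∑ d, scA N M k F (Sum.inr d) (Sum.inr true) = 2 * M - 1 - k := by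
      simp [Fintype.sum_sum_type, scA]
    rw [colSum, Fintype.sum_sum_type] at hlt
    omega

end Reduction

/-- Correctness of the Set Cover reduction (unrestricted coalition size): if every
element occurs in at most three sets of `F`, then some nonempty coalition (of any
size) has an improvement step with respect to `B` if and only if there is a set
cover of size at most `k`. -/
theorem setcover_reduction_unbounded (N M k : ℕ) (hk3 : 3 ≤ k) (hkM : k ≤ M)
    (F : Fin M → Finset (Fin N))
    (hocc : ∀ j : Fin N, occCount N M F j ≤ 3)
    (hnosmall : ∀ G : Finset (Fin M), G.card < 3 → G.biUnion F ≠ Finset.univ) :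
    (∃ (S : Finset (SCTeam N M k F)) (D : SCTeam N M k F → SCSlot N → ℕ),
        S.Nonempty ∧ IsImprovement (scA N M k F) (scB N M k F) S D) ↔
    ∃ G : Finset (Fin M), G.card ≤ k ∧ G.biUnion F = Finset.univ := by
  have hM := hk3.trans hkM
  constructor
  · rintro ⟨S, D, hS, hD⟩
    exact ⟨_, card_le_of_isImprovement hk3 hkM hocc hS hD,
      biUnion_eq_univ_of_isImprovement hM hocc hS hD⟩
  · rintro ⟨G, hGk, hG⟩
    obtain ⟨G', hGG', hG'⟩ := Finset.exists_superset_card_eq hGk (by simpa using hkM)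
    have hcover : G'.biUnion F = Finset.univ :=
      Finset.eq_univ_of_forall fun j =>
        Finset.biUnion_subset_biUnion_of_subset_left F hGG' (hG ▸ Finset.mem_univ j)
    refine ⟨_, _, ?_, isImprovement_scMoveToBeta hk3 hkM hocc hG' hcover⟩
    rw [Finset.map_nonempty, ← Finset.card_pos]
    omega

end SetCoverReduction
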